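/- arXiv:0801.4669 — 2 statements merged into one kernel-verified Lean document; each statement's English description precedes it below -/
import Mathlib

section
/- (Chattering Lemma, deterministic form.) Let T > 0 and let A₁ be a nonempty compact subset of ℝ^k. Let (q_t)_{t ∈ [0,T]} be a measurable family of Borel probability measures on A₁ (i.e. t ↦ q_t(B) is measurable for every Borel set B ⊆ A₁). Then there exists a sequence of measurable functions uⁿ : [0,T] → A₁ such that the measures δ_{uⁿ(t)}(da) dt converge weakly to q_t(da) dt on [0,T] × A₁; that is, for every bounded continuous f : [0,T] × A₁ → ℝ, ∫₀ᵀ f(t, uⁿ(t)) dt → ∫₀ᵀ ∫_{A₁} f(t,a) q_t(da) dt as n → ∞. -/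
open MeasureTheory Set Filter Topology

/-- Sampling independently on each cell of a partition into cells of mass at most `δ`, the integral
of a function bounded by `C` along the sample has the averaged integral as its mean, up to a
quadratic error of order `δ`. -/
theorem integral_sq_cellwise_sample_le {X S ι : Type*} [MeasurableSpace X] [MeasurableSpace S]
    [Fintype ι] [MeasurableSpace ι] [MeasurableSingletonClass ι]
    (μ : Measure X) [IsFiniteMeasure μ] (ν : Measure S) [IsProbabilityMeasure ν]
    {idx : X → ι} (hidx : Measurable idx) {δ : ℝ} (hδ : ∀ i, μ.real (idx ⁻¹' {i}) ≤ δ)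
    {φ : X × S → ℝ} (hφ : Measurable φ) {C : ℝ} (hC : ∀ p, |φ p| ≤ C) :
    Integrable (fun ω : ι → S => (∫ x, φ (x, ω (idx x)) ∂μ - ∫ x, ∫ s, φ (x, s) ∂ν ∂μ) ^ 2)
      (Measure.pi fun _ => ν) ∧
    ∫ ω : ι → S, (∫ x, φ (x, ω (idx x)) ∂μ - ∫ x, ∫ s, φ (x, s) ∂ν ∂μ) ^ 2
      ∂(Measure.pi fun _ => ν) ≤ C ^ 2 * δ * μ.real univ := by
  have hJ : ∀ i, MeasurableSet (idx ⁻¹' {i}) := fun i => hidx (measurableSet_singleton i)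
  have hdisj : Pairwise (Function.onFun Disjoint fun i => idx ⁻¹' {i}) := fun i j hij =>
    Disjoint.preimage _ (by simpa using hij)
  have hcover : ⋃ i, idx ⁻¹' {i} = univ := by ext x; simp
  have hsplit : ∀ F : X → ℝ, Integrable F μ → ∫ x, F x ∂μ = ∑ i, ∫ x in idx ⁻¹' {i}, F x ∂μ := by
    intro F hF
    rw [← integral_iUnion_fintype hJ hdisj fun i => hF.integrableOn, hcover, Measure.restrict_univ]
  set Y : ι → S → ℝ := fun i s => ∫ x in idx ⁻¹' {i}, φ (x, s) ∂μ with hYdef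
  have hYmeas : ∀ i, StronglyMeasurable (Y i) := fun i =>
    (hφ.comp measurable_swap).stronglyMeasurable.integral_prod_right'
  have hYbound : ∀ i s, |Y i s| ≤ C * μ.real (idx ⁻¹' {i}) := fun i s =>
    norm_setIntegral_le_of_norm_le_const (f := fun x => φ (x, s)) (measure_lt_top _ _)
      fun x _ => hC (x, s)
  have hYLp : ∀ i, MemLp (Y i) 2 ν := fun i =>
    MemLp.of_bound (hYmeas i).aestronglyMeasurable _ (ae_of_all _ (hYbound i))
  have hφint : Integrable φ (μ.prod ν) :=
    Integrable.of_bound hφ.aestronglyMeasurable C (ae_of_all _ hC)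
  have hsum : ∀ ω : ι → S, ∫ x, φ (x, ω (idx x)) ∂μ = ∑ i, Y i (ω i) := by
    intro ω
    rw [hsplit]
    · refine Finset.sum_congr rfl fun i _ => setIntegral_congr_fun (hJ i) fun x hx => ?_
      simp only [mem_preimage, mem_singleton_iff] at hx
      simp only [hx]
    · have : Measurable fun x => ω (idx x) := (measurable_of_finite ω).comp hidx
      exact Integrable.of_bound (hφ.comp (measurable_id.prodMk this)).aestronglyMeasurable C
        (ae_of_all _ fun x => hC _)
  have hmean : ∫ ω, (∑ i, fun ω : ι → S => Y i (ω i)) ω ∂(Measure.pi fun _ => ν) =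
      ∫ x, ∫ s, φ (x, s) ∂ν ∂μ := by
    simp only [Finset.sum_apply]
    rw [integral_finsetSum, hsplit _ hφint.integral_prod_left]
    · refine Finset.sum_congr rfl fun i _ => ?_
      rw [integral_comp_eval (μ := fun _ : ι => ν) (hYmeas i).aestronglyMeasurable]
      refine (integral_integral_swap ?_).symm
      exact Integrable.of_bound hφ.aestronglyMeasurable C (ae_of_all _ hC)
    · intro i _
      exact integrable_comp_eval (μ := fun _ : ι => ν) ((hYLp i).integrable one_le_two)
  have hLp : MemLp (∑ i, fun ω : ι → S => Y i (ω i)) 2 (Measure.pi fun _ => ν) :=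
    memLp_finsetSum' _ fun i _ =>
      (hYLp i).comp_measurePreserving (measurePreserving_eval (fun _ : ι => ν) i)
  have hfun : (fun ω : ι → S => (∫ x, φ (x, ω (idx x)) ∂μ - ∫ x, ∫ s, φ (x, s) ∂ν ∂μ) ^ 2) =
      fun ω => ((∑ i, fun ω : ι → S => Y i (ω i)) ω - ∫ x, ∫ s, φ (x, s) ∂ν ∂μ) ^ 2 := by
    funext ω
    rw [hsum ω, Finset.sum_apply]
  rw [hfun]
  refine ⟨(hLp.sub (memLp_const _)).integrable_sq, ?_⟩
  rw [← hmean, ← ProbabilityTheory.variance_eq_integral hLp.aemeasurable,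
    ProbabilityTheory.variance_sum_pi hYLp]
  calc ∑ i, ProbabilityTheory.variance (Y i) ν
      ≤ ∑ i, C ^ 2 * δ * μ.real (idx ⁻¹' {i}) := by
        refine Finset.sum_le_sum fun i _ => ?_
        have hvar := ProbabilityTheory.variance_le_sq_of_bounded (μ := ν)
          (ae_of_all _ fun s => abs_le.1 (hYbound i s)) (hYmeas i).measurable.aemeasurable
        have hm : 0 ≤ μ.real (idx ⁻¹' {i}) := measureReal_nonneg
        have := mul_le_mul_of_nonneg_left (mul_le_mul_of_nonneg_right (hδ i) hm) (sq_nonneg C)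
        nlinarith
    _ = C ^ 2 * δ * μ.real univ := by
        rw [← Finset.mul_sum, ← measureReal_iUnion_fintype hdisj hJ, hcover]

/-- A bounded interval splits measurably into finitely many cells of length at most `δ`. -/
theorem exists_measurable_fin_fibers_le (T : ℝ) {δ : ℝ} (hδ : 0 < δ) :
    ∃ (m : ℕ) (idx : ℝ → Fin m), Measurable idx ∧
      ∀ i, (volume.restrict (Ioc 0 T)).real (idx ⁻¹' {i}) ≤ δ := by
  obtain ⟨n, hn⟩ := exists_nat_gt (T / δ)
  have hmeas : Measurable fun t : ℝ => Fin.ofNat (n + 1) ⌊t / δ⌋₊ :=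
    (measurable_from_nat (f := Fin.ofNat (n + 1))).comp
      (Nat.measurable_floor.comp (measurable_id.div_const δ))
  refine ⟨n + 1, _, hmeas, fun i => ?_⟩
  rw [measureReal_restrict_apply (hmeas (measurableSet_singleton i))]
  have hsub : (fun t : ℝ => Fin.ofNat (n + 1) ⌊t / δ⌋₊) ⁻¹' {i} ∩ Ioc 0 T ⊆
      Icc (i * δ) ((i + 1) * δ) := by
    rintro t ⟨hti, ht0, htT⟩
    have h0 : 0 ≤ t / δ := (div_pos ht0 hδ).le
    have hlt : ⌊t / δ⌋₊ < n + 1 :=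
      ((Nat.floor_lt h0).2 ((div_le_div_of_nonneg_right htT hδ.le).trans_lt hn)).trans
        (Nat.lt_succ_self n)
    have hi : ⌊t / δ⌋₊ = (i : ℕ) := by
      rw [← (hti : Fin.ofNat (n + 1) ⌊t / δ⌋₊ = i), Fin.val_ofNat, Nat.mod_eq_of_lt hlt]
    have h1 := Nat.floor_le h0
    have h2 := Nat.lt_floor_add_one (t / δ)
    rw [hi] at h1 h2
    exact ⟨(le_div_iff₀ hδ).1 h1, ((div_lt_iff₀ hδ).1 h2).le⟩
  calc volume.real _ ≤ volume.real (Icc ((i : ℝ) * δ) ((i + 1) * δ)) :=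
        measureReal_mono hsub measure_Icc_lt_top.ne
    _ = δ := by
        rw [Real.volume_real_Icc_of_le (by nlinarith)]
        ring

/-- Averages over an auxiliary probability space of countably many bounded functions are
simultaneously limits of evaluations along measurable selections. -/
theorem exists_seq_measurable_tendsto_integral_integral {S : Type*} [MeasurableSpace S]
    (ν : Measure S) [IsProbabilityMeasure ν] (T : ℝ) (φ : ℕ → ℝ × S → ℝ)
    (hφ : ∀ j, Measurable (φ j)) (hbdd : ∀ j, ∃ C, ∀ p, |φ j p| ≤ C) :
    ∃ σ : ℕ → ℝ → S, (∀ n, Measurable (σ n)) ∧ ∀ j,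
      Tendsto (fun n => ∫ t in Ioc 0 T, φ j (t, σ n t)) atTop
        (𝓝 (∫ t in Ioc 0 T, ∫ s, φ j (t, s) ∂ν)) := by
  choose C hC using hbdd
  set μ : Measure ℝ := volume.restrict (Ioc 0 T)
  have key : ∀ n : ℕ, ∃ s : ℝ → S, Measurable s ∧ ∀ j < n,
      (∫ t, φ j (t, s t) ∂μ - ∫ t, ∫ s, φ j (t, s) ∂ν ∂μ) ^ 2 ≤ 1 / ((n : ℝ) + 1) := by
    intro n
    set M : ℝ := ∑ j ∈ Finset.range n, C j ^ 2 * μ.real univ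
    have hM : 0 ≤ M := Finset.sum_nonneg fun j _ => mul_nonneg (sq_nonneg _) measureReal_nonneg
    have hn : (0 : ℝ) < n + 1 := by positivity
    set δ : ℝ := 1 / ((n + 1) * (M + 1))
    have hδ : 0 < δ := by positivity
    obtain ⟨m, idx, hidx, hcell⟩ := exists_measurable_fin_fibers_le T hδ
    have hmom := fun j => integral_sq_cellwise_sample_le μ ν hidx hcell (hφ j) (hC j)
    obtain ⟨ω, hω⟩ := exists_le_integral
      (integrable_finsetSum (Finset.range n) fun j _ => (hmom j).1)
    refine ⟨fun t => ω (idx t), (measurable_of_finite ω).comp hidx, fun j hj => ?_⟩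
    calc _ ≤ ∑ j ∈ Finset.range n,
          (∫ t, φ j (t, ω (idx t)) ∂μ - ∫ t, ∫ s, φ j (t, s) ∂ν ∂μ) ^ 2 :=
        Finset.single_le_sum (f := fun j =>
          (∫ t, φ j (t, ω (idx t)) ∂μ - ∫ t, ∫ s, φ j (t, s) ∂ν ∂μ) ^ 2)
          (fun j _ => sq_nonneg _) (Finset.mem_range.2 hj)
      _ ≤ ∑ j ∈ Finset.range n, C j ^ 2 * δ * μ.real univ := by
        refine hω.trans ?_
        rw [integral_finsetSum _ fun j _ => (hmom j).1]
        exact Finset.sum_le_sum fun j _ => (hmom j).2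
      _ = δ * M := by
        rw [Finset.mul_sum]
        exact Finset.sum_congr rfl fun j _ => by ring
      _ ≤ δ * (M + 1) := by gcongr; linarith
      _ = 1 / ((n : ℝ) + 1) := by
        simp only [δ]
        field_simp
  choose σ hσ hσφ using key
  refine ⟨σ, hσ, fun j => ?_⟩
  rw [tendsto_iff_norm_sub_tendsto_zero]
  have hsq : Tendsto (fun n => (∫ t, φ j (t, σ n t) ∂μ - ∫ t, ∫ s, φ j (t, s) ∂ν ∂μ) ^ 2) atTop
      (𝓝 0) :=
    squeeze_zero' (Eventually.of_forall fun n => sq_nonneg _)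
      ((eventually_gt_atTop j).mono fun n hn => hσφ n j hn)
      tendsto_one_div_add_atTop_nhds_zero_nat
  simpa [Real.sqrt_sq_eq_abs] using hsq.sqrt

/-- Convergence of integrals along measurable curves passes from a dense family of continuous
functions on a compact space to all of them. -/
theorem tendsto_integral_comp_of_denseRange {X S K : Type*} [MeasurableSpace X] [MeasurableSpace S]
    [TopologicalSpace K] [CompactSpace K] [MeasurableSpace K] [OpensMeasurableSpace K]
    (μ : Measure X) [IsFiniteMeasure μ] (ν : Measure S) [IsProbabilityMeasure ν]
    {G : X × S → K} (hG : Measurable G) {σ : ℕ → X → S} (hσ : ∀ n, Measurable (σ n))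
    {F : ℕ → C(K, ℝ)} (hF : DenseRange F)
    (hlim : ∀ j, Tendsto (fun n => ∫ x, F j (G (x, σ n x)) ∂μ) atTop
      (𝓝 (∫ x, ∫ s, F j (G (x, s)) ∂ν ∂μ))) (f : C(K, ℝ)) :
    Tendsto (fun n => ∫ x, f (G (x, σ n x)) ∂μ) atTop (𝓝 (∫ x, ∫ s, f (G (x, s)) ∂ν ∂μ)) := by
  have hfint : ∀ (h : C(K, ℝ)) (n : ℕ), Integrable (fun x => h (G (x, σ n x))) μ := fun h n =>
    Integrable.of_bound (h.continuous.measurable.comp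
      (hG.comp (measurable_id.prodMk (hσ n)))).aestronglyMeasurable ‖h‖
      (ae_of_all _ fun x => h.norm_coe_le_norm _)
  have hfint_prod : ∀ h : C(K, ℝ), Integrable (fun p => h (G p)) (μ.prod ν) := fun h =>
    Integrable.of_bound (h.continuous.measurable.comp hG).aestronglyMeasurable ‖h‖
      (ae_of_all _ fun x => h.norm_coe_le_norm _)
  rw [Metric.tendsto_atTop]
  intro ε hε
  set M : ℝ := μ.real univ
  have hM : 0 ≤ M := measureReal_nonneg
  obtain ⟨j, hj⟩ := hF.exists_dist_lt f (show 0 < ε / (3 * (M + 1)) by positivity)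
  have hclose : ∀ y, ‖f y - F j y‖ ≤ ε / (3 * (M + 1)) := fun y =>
    ((f - F j).norm_coe_le_norm y).trans (by rw [← dist_eq_norm]; exact hj.le)
  have hsmall : ε / (3 * (M + 1)) * M < ε / 3 := by
    rw [div_mul_eq_mul_div, div_lt_div_iff₀ (by positivity) (by norm_num)]
    nlinarith
  obtain ⟨N, hN⟩ := Metric.tendsto_atTop.1 (hlim j) (ε / 3) (by positivity)
  refine ⟨N, fun n hn => ?_⟩
  have h1 : |∫ x, f (G (x, σ n x)) ∂μ - ∫ x, F j (G (x, σ n x)) ∂μ| < ε / 3 := by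
    rw [← integral_sub (hfint f n) (hfint (F j) n)]
    exact (norm_integral_le_of_norm_le_const (ae_of_all _ fun x => hclose _)).trans_lt hsmall
  have h2 : |∫ x, ∫ s, f (G (x, s)) ∂ν ∂μ - ∫ x, ∫ s, F j (G (x, s)) ∂ν ∂μ| < ε / 3 := by
    rw [integral_integral (hfint_prod f), integral_integral (hfint_prod (F j)),
      ← integral_sub (hfint_prod f) (hfint_prod (F j))]
    refine (norm_integral_le_of_norm_le_const (ae_of_all _ fun x => hclose _)).trans_lt ?_
    simpa [Measure.real, ← univ_prod_univ, M] using hsmall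
  have h3 := hN n hn
  rw [Real.dist_eq] at h3 ⊢
  rw [abs_lt] at *
  constructor <;> linarith [h1.1, h1.2, h2.1, h2.2, h3.1, h3.2]

/-- Chattering Lemma (deterministic form). Let `A₁ ⊂ ℝ^k` be nonempty and compact and let
`(q_t)_{t ∈ [0,T]}` be a measurable family of Borel probability measures concentrated on
`A₁`. Then there is a sequence of measurable `A₁`-valued controls `uⁿ` such that the
measures `δ_{uⁿ(t)}(da) dt` converge weakly to `q_t(da) dt`: for every bounded continuous
`f : [0,T] × ℝ^k → ℝ`, `∫₀ᵀ f(t, uⁿ(t)) dt → ∫₀ᵀ ∫_{A₁} f(t,a) q_t(da) dt`. -/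
theorem chattering_lemma_deterministic (T : ℝ) (hT : 0 < T) {k : ℕ}
    (A₁ : Set (Fin k → ℝ)) (hne : A₁.Nonempty) (hcomp : IsCompact A₁)
    (q : ℝ → Measure (Fin k → ℝ))
    (hprob : ∀ t, IsProbabilityMeasure (q t))
    (hsupp : ∀ t, q t A₁ᶜ = 0)
    (hmeas : ∀ B : Set (Fin k → ℝ), MeasurableSet B → Measurable fun t => q t B) :
    ∃ u : ℕ → ℝ → Fin k → ℝ,
      (∀ n, Measurable (u n)) ∧ (∀ n, ∀ t, u n t ∈ A₁) ∧
      ∀ f : ℝ × (Fin k → ℝ) → ℝ, Continuous f → (∃ C : ℝ, ∀ p, |f p| ≤ C) →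
        Tendsto (fun n : ℕ => ∫ t in (0 : ℝ)..T, f (t, u n t)) atTop
          (𝓝 (∫ t in (0 : ℝ)..T, ∫ a, f (t, a) ∂(q t))) := by
  have hA : MeasurableSet A₁ := hcomp.measurableSet
  have : CompactSpace A₁ := isCompact_iff_compactSpace.1 hcomp
  have : Nonempty A₁ := hne.to_subtype
  have hqA : ∀ t, (q t).restrict A₁ = q t := fun t =>
    Measure.restrict_eq_self_of_ae_mem (mem_ae_iff.2 (hsupp t))
  let κ : ProbabilityTheory.Kernel ℝ A₁ :=
    { toFun := fun t => (q t).comap Subtype.val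
      measurable' := by
        refine Measure.measurable_of_measurable_coe _ fun B hB => ?_
        simp_rw [comap_subtype_coe_apply hA]
        exact hmeas _ (hA.subtype_image hB) }
  have hκ : ∀ t, κ t = (q t).comap Subtype.val := fun t => rfl
  have : ProbabilityTheory.IsMarkovKernel κ := ⟨fun t => ⟨by
    rw [hκ, comap_subtype_coe_apply hA, image_univ, Subtype.range_coe,
      ← Measure.restrict_apply_self, hqA t]
    have h := (hprob t).measure_univ
    rwa [← hqA t, Measure.restrict_apply_univ] at h⟩⟩
  obtain ⟨g, hg, hgκ⟩ := κ.exists_measurable_map_eq_unitInterval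
  let G : ℝ × unitInterval → Icc 0 T × A₁ := fun p => (projIcc 0 T hT.le p.1, g p.1 p.2)
  have hG : Measurable G :=
    (continuous_projIcc.measurable.comp measurable_fst).prodMk hg
  let F : ℕ → C(Icc 0 T × A₁, ℝ) := TopologicalSpace.denseSeq _
  obtain ⟨σ, hσ, hlim⟩ := exists_seq_measurable_tendsto_integral_integral (volume : Measure unitInterval) T
    (fun j p => F j (G p)) (fun j => (F j).continuous.measurable.comp hG)
    fun j => ⟨‖F j‖, fun p => (F j).norm_coe_le_norm _⟩
  refine ⟨fun n t => g t (σ n t),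
    fun n => measurable_subtype_coe.comp (hg.comp (measurable_id.prodMk (hσ n))),
    fun n t => (g t (σ n t)).2, fun f hf _ => ?_⟩
  have h := tendsto_integral_comp_of_denseRange (volume.restrict (Ioc 0 T)) (volume : Measure unitInterval)
    hG hσ (TopologicalSpace.denseRange_denseSeq _) hlim
    ⟨fun p => f (p.1, p.2), by fun_prop⟩
  simp only [intervalIntegral.integral_of_le hT.le]
  have hproj : ∀ t ∈ Ioc 0 T, (projIcc 0 T hT.le t : ℝ) = t := fun t ht => by
    rw [projIcc_of_mem hT.le (Ioc_subset_Icc_self ht)]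
  convert h using 2
  · refine setIntegral_congr_fun measurableSet_Ioc fun t ht => ?_
    simp [G, hproj t ht]
  · refine setIntegral_congr_fun measurableSet_Ioc fun t ht => ?_
    simp only [G, ContinuousMap.coe_mk, hproj t ht]
    rw [← hqA t, ← integral_subtype_comap hA fun a => f (t, a), ← hκ, ← hgκ t,
      integral_map hg.of_uncurry_left.aemeasurable]
    exact (hf.comp (by fun_prop)).aestronglyMeasurable
end

section
/- (Chattering Lemma.) Let (Ω, 𝓕, (𝓕_t)_{t≥0}, P) be a filtered probability space, T > 0, and let A₁ be a nonempty compact subset of ℝ^k. Let (q_t)_{t ∈ [0,T]} be a progressively measurable process with values in the space of Borel probability measures on A₁ (endowed with the topology of weak convergence). Then there exists a sequence of progressively measurable processes (uⁿ_t)_{t ∈ [0,T]} with values in A₁ such that, for P-almost every ω, the measures δ_{uⁿ_t(ω)}(da) dt converge weakly to q_t(ω)(da) dt on [0,T] × A₁ as n → ∞; that is, for P-a.e. ω and every bounded continuous f : [0,T] × A₁ → ℝ, ∫₀ᵀ f(t, uⁿ_t(ω)) dt → ∫₀ᵀ ∫_{A₁} f(t,a) q_t(ω)(da) dt. -/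
open MeasureTheory Set Filter Topology

section Quantile

open ProbabilityTheory

/-- The lower quantile function of a measure on `ℝ`, taken within a set `K`. -/
noncomputable def quantileOn (K : Set ℝ) (ν : Measure ℝ) (s : ℝ) : ℝ :=
  sInf {x ∈ K | s ≤ cdf ν x}

variable {K : Set ℝ} {ν : Measure ℝ} [IsProbabilityMeasure ν] {s : ℝ}

lemma cdf_sSup_inter_Iic (hK : IsCompact K) (hν : ν Kᶜ = 0) {y : ℝ}
    (hy : (K ∩ Iic y).Nonempty) : cdf ν (sSup (K ∩ Iic y)) = cdf ν y := by
  have hc : IsCompact (K ∩ Iic y) := hK.inter_right isClosed_Iic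
  refine le_antisymm (monotone_cdf ν (hc.sSup_mem hy).2) ?_
  rw [cdf_eq_real, cdf_eq_real]
  refine ENNReal.toReal_mono (measure_ne_top _ _) ?_
  calc ν (Iic y) = ν (Iic y ∩ K) := (measure_inter_conull hν).symm
    _ ≤ _ := measure_mono fun x hx ↦ le_csSup hc.bddAbove ⟨hx.2, hx.1⟩

lemma exists_mem_le_cdf (hK : IsCompact K) (hν : ν Kᶜ = 0) (hs : s ≤ 1) :
    {x ∈ K | s ≤ cdf ν x}.Nonempty := by
  have hne : K.Nonempty := by
    by_contra h
    rw [not_nonempty_iff_eq_empty] at h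
    simp [h] at hν
  refine ⟨sSup K, hK.sSup_mem hne, hs.trans ?_⟩
  have h1 : ν (Iic (sSup K)) = 1 := (prob_compl_eq_zero_iff measurableSet_Iic).1
    (measure_mono_null (compl_subset_compl.2 fun x hx ↦ le_csSup hK.bddAbove hx) hν)
  simp [cdf_eq_real, measureReal_def, h1]

lemma quantileOn_mem (hK : IsCompact K) (hν : ν Kᶜ = 0) (hs : s ≤ 1) :
    quantileOn K ν s ∈ K ∧ s ≤ cdf ν (quantileOn K ν s) := by
  have hne := exists_mem_le_cdf hK hν hs
  have hbdd : BddBelow {x ∈ K | s ≤ cdf ν x} := hK.bddBelow.mono fun x hx ↦ hx.1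
  constructor
  · exact closure_minimal (fun x hx ↦ hx.1) hK.isClosed (csInf_mem_closure hne hbdd)
  · have h := (cdf ν).right_continuous (quantileOn K ν s)
    have h' : Tendsto (cdf ν) (𝓝[>] (quantileOn K ν s)) (𝓝 (cdf ν (quantileOn K ν s))) :=
      h.mono_left (nhdsWithin_mono _ Ioi_subset_Ici_self)
    refine ge_of_tendsto h' ?_
    filter_upwards [self_mem_nhdsWithin] with x hx
    obtain ⟨z, hz, hzx⟩ := exists_lt_of_csInf_lt hne (mem_Ioi.1 hx)
    exact hz.2.trans (monotone_cdf ν hzx.le)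

lemma quantileOn_le_iff (hK : IsCompact K) (hν : ν Kᶜ = 0) (hs : s ≤ 1) (y : ℝ) :
    quantileOn K ν s ≤ y ↔ sInf K ≤ y ∧ s ≤ cdf ν y := by
  have hm := quantileOn_mem hK hν hs
  constructor
  · intro h
    exact ⟨(csInf_le hK.bddBelow hm.1).trans h, hm.2.trans (monotone_cdf ν h)⟩
  · rintro ⟨h1, h2⟩
    have hne : (K ∩ Iic y).Nonempty := ⟨sInf K, hK.sInf_mem ⟨_, hm.1⟩, h1⟩
    have hx := (hK.inter_right (isClosed_Iic (a := y))).sSup_mem hne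
    refine le_trans (csInf_le (hK.bddBelow.mono fun x hx ↦ hx.1)
      (mem_sep hx.1 ?_)) hx.2
    rwa [cdf_sSup_inter_Iic hK hν hne]

lemma monotoneOn_quantileOn (hK : IsCompact K) (hν : ν Kᶜ = 0) :
    MonotoneOn (quantileOn K ν) (Iic 1) := fun _ _ _ hs' h ↦
  csInf_le_csInf (hK.bddBelow.mono fun _ hx ↦ hx.1) (exists_mem_le_cdf hK hν hs')
    fun _ hx ↦ ⟨hx.1, h.trans hx.2⟩

lemma measurable_quantileOn {α : Type*} {_ : MeasurableSpace α} {μ : α → Measure ℝ}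
    [∀ a, IsProbabilityMeasure (μ a)] (hμ : Measurable μ) (hK : IsCompact K)
    (hμK : ∀ a, μ a Kᶜ = 0) {s : α → ℝ} (hs : Measurable s) (hs1 : ∀ a, s a ≤ 1) :
    Measurable fun a ↦ quantileOn K (μ a) (s a) := by
  refine measurable_of_Iic fun y ↦ ?_
  have : (fun a ↦ quantileOn K (μ a) (s a)) ⁻¹' Iic y
      = {a | sInf K ≤ y ∧ s a ≤ (μ a).real (Iic y)} := by
    ext a
    simp [quantileOn_le_iff hK (hμK a) (hs1 a), cdf_eq_real]
  rw [this]
  refine (MeasurableSet.const _).inter (measurableSet_le hs ?_)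
  exact ((Measure.measurable_coe measurableSet_Iic).comp hμ).ennreal_toReal

lemma map_quantileOn (hK : IsCompact K) (hν : ν Kᶜ = 0) :
    (volume.restrict (Ico (0 : ℝ) 1)).map (quantileOn K ν) = ν := by
  have hmeas : AEMeasurable (quantileOn K ν) (volume.restrict (Ico (0 : ℝ) 1)) :=
    aemeasurable_restrict_of_monotoneOn measurableSet_Ico
      ((monotoneOn_quantileOn hK hν).mono fun x hx ↦ hx.2.le)
  have : IsFiniteMeasure ((volume.restrict (Ico (0 : ℝ) 1)).map (quantileOn K ν)) := by
    infer_instance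
  refine Measure.ext_of_Iic _ _ fun y ↦ ?_
  rw [Measure.map_apply_of_aemeasurable hmeas measurableSet_Iic,
    Measure.restrict_apply' measurableSet_Ico]
  by_cases hy : sInf K ≤ y
  · have : quantileOn K ν ⁻¹' Iic y ∩ Ico 0 1 = Iic (cdf ν y) ∩ Ico 0 1 := by
      ext s
      simp only [mem_inter_iff, mem_preimage, mem_Iic, and_congr_left_iff]
      intro hs
      rw [quantileOn_le_iff hK hν hs.2.le]
      simp [hy]
    have h1 : (Iic (cdf ν y) ∩ Ico (0 : ℝ) 1 : Set ℝ) =ᵐ[volume] Icc 0 (cdf ν y) := by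
      have h2 : (Ico (0 : ℝ) 1 : Set ℝ) =ᵐ[volume] Icc 0 1 := Ico_ae_eq_Icc
      have h3 : Icc 0 (cdf ν y) = Iic (cdf ν y) ∩ Icc 0 1 := by
        ext x
        have := cdf_le_one ν y
        simp only [mem_Icc, mem_inter_iff, mem_Iic]
        grind
      rw [h3]
      exact (ae_eq_refl _).inter h2
    rw [this, measure_congr h1, Real.volume_Icc, sub_zero, ofReal_cdf]
  · have h1 : quantileOn K ν ⁻¹' Iic y ∩ Ico 0 1 = ∅ := by
      ext s
      simp only [mem_inter_iff, mem_preimage, mem_Iic, mem_empty_iff_false, iff_false, not_and]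
      intro h hs
      exact hy ((quantileOn_le_iff hK hν hs.2.le y).1 h).1
    rw [h1, measure_empty, eq_comm]
    refine measure_mono_null (t := Kᶜ) (fun x hx hxK ↦ hy ?_) hν
    exact (csInf_le hK.bddBelow hxK).trans hx

end Quantile

section Param

/-- A nonempty compact subset of `Fin k → ℝ` is the continuous image of a compact set of
reals, and the parametrization admits a Borel right inverse. -/
lemma exists_continuousMap_measurable_section {k : ℕ} {A : Set (Fin k → ℝ)} (hne : A.Nonempty)
    (hA : IsCompact A) :
    ∃ (π : C(ℝ, Fin k → ℝ)) (e : (Fin k → ℝ) → ℝ), Measurable e ∧ MapsTo π cantorSet A ∧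
      ∀ x ∈ A, e x ∈ cantorSet ∧ π (e x) = x := by
  have : Nonempty A := hne.to_subtype
  have : CompactSpace A := isCompact_iff_compactSpace.1 hA
  obtain ⟨g, hg, hgs⟩ := exists_nat_bool_continuous_surjective_of_compact A
  let φ : C(cantorSet, Fin k → ℝ) :=
    ⟨fun x ↦ g (cantorSetHomeomorphNatToBool x),
      continuous_subtype_val.comp (hg.comp cantorSetHomeomorphNatToBool.continuous)⟩
  obtain ⟨π, hπ⟩ := ContinuousMap.exists_restrict_eq isClosed_cantorSet φ
  have hπφ : ∀ c (hc : c ∈ cantorSet), π c = φ ⟨c, hc⟩ := fun c hc ↦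
    DFunLike.congr_fun hπ ⟨c, hc⟩
  let S : (Fin k → ℝ) → Set ℝ := fun x ↦ cantorSet ∩ π ⁻¹' {x}
  have hS : ∀ x, IsCompact (S x) := fun x ↦
    isCompact_cantorSet.inter_right (isClosed_singleton.preimage π.continuous)
  have hmaps : MapsTo π cantorSet A := fun c hc ↦ by
    rw [hπφ c hc]
    exact Subtype.coe_prop _
  have hSne : ∀ x ∈ A, (S x).Nonempty := by
    intro x hx
    obtain ⟨b, hb⟩ := hgs ⟨x, hx⟩
    refine ⟨cantorSetHomeomorphNatToBool.symm b, Subtype.coe_prop _, ?_⟩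
    rw [mem_preimage, hπφ _ (Subtype.coe_prop _)]
    simp [φ, hb]
  have hmem : ∀ x ∈ A, sInf (S x) ∈ S x := fun x hx ↦ (hS x).sInf_mem (hSne x hx)
  refine ⟨π, fun x ↦ sInf (S x), ?_, hmaps, fun x hx ↦ hmem x hx⟩
  refine measurable_of_Iic fun y ↦ ?_
  have : (fun x ↦ sInf (S x)) ⁻¹' Iic y
      = π '' (cantorSet ∩ Iic y) ∪ (Aᶜ ∩ {_x | 0 ≤ y}) := by
    ext x
    by_cases hx : x ∈ A
    · simp only [mem_preimage, mem_Iic, mem_union, mem_inter_iff, mem_compl_iff, hx,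
        not_true_eq_false, false_and, or_false]
      constructor
      · intro h
        exact ⟨_, ⟨(hmem x hx).1, h⟩, (hmem x hx).2⟩
      · rintro ⟨c, ⟨hc, hcy⟩, rfl⟩
        exact (csInf_le (hS _).bddBelow ⟨hc, rfl⟩).trans hcy
    · have hSx : S x = ∅ := by
        rw [← not_nonempty_iff_eq_empty]
        rintro ⟨c, hc, rfl⟩
        exact hx (hmaps hc)
      have : x ∉ π '' (cantorSet ∩ Iic y) := by
        rintro ⟨c, ⟨hc, -⟩, rfl⟩
        exact hx (hmaps hc)
      simp [hSx, hx, this]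
  rw [this]
  refine MeasurableSet.union ?_ (hA.measurableSet.compl.inter (MeasurableSet.const _))
  exact ((isCompact_cantorSet.inter_right isClosed_Iic).image π.continuous).measurableSet

/-- Weak measurability of a random probability measure implies measurability into the space of
measures with the σ-algebra generated by evaluations. -/
lemma MeasureTheory.StronglyMeasurable.measurable_toMeasure {α X : Type*} {_ : MeasurableSpace α}
    [TopologicalSpace X] [MeasurableSpace X] [BorelSpace X] [HasOuterApproxClosed X]
    {q : α → ProbabilityMeasure X} (hq : StronglyMeasurable q) :
    Measurable fun a ↦ (q a : Measure X) := by
  refine Measurable.measure_of_isPiSystem_of_isProbabilityMeasure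
    (borel_eq_generateFrom_isClosed (α := X) ▸ BorelSpace.measurable_eq) isPiSystem_isClosed
    fun B hB ↦ ?_
  refine measurable_of_tendsto_metrizable (f := fun n a ↦ ∫⁻ x, hB.apprSeq n x ∂(q a : Measure X))
    (fun n ↦ ?_) (tendsto_pi_nhds.2 fun a ↦ HasOuterApproxClosed.tendsto_lintegral_apprSeq hB _)
  exact ((ProbabilityMeasure.continuous_lintegral_boundedContinuousFunction
    _).comp_stronglyMeasurable hq).measurable

end Param

section Equidistribution

open Measure

lemma tendsto_integral_norm_translate_sub {h : ℝ → ℝ} (hh : Integrable h) :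
    Tendsto (fun c : ℝ ↦ ∫ t, ‖h (c + t) - h t‖) (𝓝 0) (𝓝 0) := by
  have hm : MemLp h 1 := memLp_one_iff_integrable.2 hh
  have hp : Fact ((1 : ENNReal) ≠ ⊤) := ⟨ENNReal.one_ne_top⟩
  have hcont : Continuous fun c : ℝ ↦ ‖(DomAddAct.mk c +ᵥ hm.toLp h) - hm.toLp h‖ := by
    have : Continuous fun c : ℝ ↦ DomAddAct.mk c := DomAddAct.continuous_mk
    fun_prop
  have h0 := hcont.tendsto 0
  have heq : ∀ c : ℝ, ‖(DomAddAct.mk c +ᵥ hm.toLp h) - hm.toLp h‖ = ∫ t, ‖h (c + t) - h t‖ := by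
    intro c
    have hc := DomAddAct.mk_vadd_toLp (μ := volume) c hm
    rw [hc, ← MemLp.toLp_sub, L1.norm_eq_integral_norm]
    refine integral_congr_ae ?_
    filter_upwards [MemLp.coeFn_toLp ((hm.comp_measurePreserving
      (measurePreserving_vadd c volume)).sub hm)] with t ht
    refine (congrArg norm ht).trans ?_
    simp
  simp only [heq] at h0
  simpa using h0

/-- Indicator of the `i`-th of the `N` equal subintervals of a period. -/
noncomputable def phaseIndicator (N i : ℕ) (x : ℝ) : ℝ :=
  if ⌊N * Int.fract x⌋₊ = i then 1 else 0

lemma measurable_phaseIndicator (N i : ℕ) : Measurable (phaseIndicator N i) := by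
  refine Measurable.ite ?_ measurable_const measurable_const
  exact (Nat.measurable_floor.comp (measurable_fract.const_mul (N : ℝ)))
    (measurableSet_singleton i)

lemma norm_phaseIndicator_le_one (N i : ℕ) (x : ℝ) : ‖phaseIndicator N i x‖ ≤ 1 := by
  unfold phaseIndicator
  split_ifs <;> simp

lemma floor_mul_lt {N : ℕ} (hN : 0 < N) {s : ℝ} (hs : s < 1) : ⌊N * s⌋₊ < N := by
  have hN' : (0 : ℝ) < N := by exact_mod_cast hN
  rw [Nat.floor_lt' hN.ne']
  nlinarith

lemma phaseIndicator_add_div {N i : ℕ} (hi : i < N) (x : ℝ) :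
    phaseIndicator N i (x + i / N) = phaseIndicator N 0 x := by
  have hN : (0 : ℝ) < N := by exact_mod_cast (Nat.zero_le i).trans_lt hi
  have hx0 := Int.fract_nonneg x
  have hx1 := Int.fract_lt_one x
  have hi1 : (i : ℝ) + 1 ≤ N := by exact_mod_cast hi
  have key : ⌊N * Int.fract (x + i / N)⌋₊ = i ↔ ⌊N * Int.fract x⌋₊ = 0 := by
    have hd0 : (0 : ℝ) ≤ i / N := by positivity
    have hd1 : (i : ℝ) / N + (N : ℝ)⁻¹ ≤ 1 := by
      rw [← one_div, ← add_div, div_le_one hN]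
      exact hi1
    rw [Nat.floor_eq_iff (mul_nonneg hN.le (Int.fract_nonneg _)), Nat.floor_eq_zero,
      ← div_le_iff₀' hN, ← lt_div_iff₀' hN, ← lt_div_iff₀' hN, add_div, one_div]
    constructor
    · rintro ⟨h1, h2⟩
      have : Int.fract x = Int.fract (x + i / N) - i / N := by
        rw [Int.fract_eq_iff]
        refine ⟨by linarith, by linarith, ⌊x + i / N⌋, ?_⟩
        have := Int.floor_add_fract (x + i / N)
        linarith
      linarith
    · intro h
      have : Int.fract (x + i / N) = Int.fract x + i / N := by
        rw [Int.fract_eq_iff]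
        refine ⟨by linarith, by linarith, ⌊x⌋, ?_⟩
        have := Int.floor_add_fract x
        linarith
      rw [this]
      constructor <;> linarith
  simp only [phaseIndicator, key]

lemma integrable_mul_phaseIndicator {h : ℝ → ℝ} (hh : Integrable h) (N i n : ℕ) :
    Integrable fun t ↦ h t * phaseIndicator N i (n * t) :=
  hh.mul_bdd ((measurable_phaseIndicator N i).comp
      (measurable_const.mul measurable_id)).aestronglyMeasurable
    (ae_of_all _ fun _ ↦ norm_phaseIndicator_le_one _ _ _)

lemma tendsto_integral_mul_phaseIndicator_sub {h : ℝ → ℝ} (hh : Integrable h) {N i : ℕ}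
    (hi : i < N) :
    Tendsto (fun n : ℕ ↦ (∫ t, h t * phaseIndicator N i (n * t))
      - ∫ t, h t * phaseIndicator N 0 (n * t)) atTop (𝓝 0) := by
  have hc : Tendsto (fun n : ℕ ↦ (i / N : ℝ) / n) atTop (𝓝 0) :=
    tendsto_const_div_atTop_nhds_zero_nat _
  refine squeeze_zero_norm' ?_ ((tendsto_integral_norm_translate_sub hh).comp hc)
  filter_upwards [eventually_gt_atTop 0] with n hn
  have hn' : (n : ℝ) ≠ 0 := by positivity
  set c : ℝ := (i / N : ℝ) / n with hcdef
  have h1 : ∫ t, h t * phaseIndicator N i (n * t)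
      = ∫ t, h (c + t) * phaseIndicator N 0 (n * t) := by
    rw [← integral_add_left_eq_self _ c]
    refine integral_congr_ae (ae_of_all _ fun t ↦ ?_)
    have : (n : ℝ) * (c + t) = n * t + i / N := by rw [hcdef]; field_simp; ring
    simp only [this, phaseIndicator_add_div hi]
  rw [h1, ← integral_sub (integrable_mul_phaseIndicator (hh.comp_add_left c) N 0 n)
    (integrable_mul_phaseIndicator hh N 0 n)]
  refine norm_integral_le_of_norm_le ((hh.comp_add_left c).sub hh).norm (ae_of_all _ fun t ↦ ?_)
  rw [← sub_mul, norm_mul]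
  exact mul_le_of_le_one_right (norm_nonneg _) (norm_phaseIndicator_le_one _ _ _)

lemma sum_mul_phaseIndicator {N : ℕ} (hN : 0 < N) (h : ℕ → ℝ) (x : ℝ) :
    ∑ i ∈ Finset.range N, h i * phaseIndicator N i x = h ⌊N * Int.fract x⌋₊ := by
  simp [phaseIndicator, floor_mul_lt hN (Int.fract_lt_one x)]

/-- Fejér's lemma for the indicators of equal subintervals of a period. -/
lemma tendsto_integral_mul_phaseIndicator {h : ℝ → ℝ} (hh : Integrable h) {N i : ℕ}
    (hi : i < N) :
    Tendsto (fun n : ℕ ↦ ∫ t, h t * phaseIndicator N i (n * t)) atTop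
      (𝓝 ((N : ℝ)⁻¹ * ∫ t, h t)) := by
  have hN : 0 < N := (Nat.zero_le i).trans_lt hi
  have hN' : (N : ℝ) ≠ 0 := by positivity
  have hsum : ∀ n : ℕ, ∑ j ∈ Finset.range N, ∫ t, h t * phaseIndicator N j (n * t)
      = ∫ t, h t := by
    intro n
    rw [← integral_finsetSum _ fun j _ ↦ integrable_mul_phaseIndicator hh N j n]
    exact integral_congr_ae (ae_of_all _ fun t ↦ sum_mul_phaseIndicator hN (fun _ ↦ h t) _)
  have h0 : Tendsto (fun n : ℕ ↦ ∑ j ∈ Finset.range N,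
      ((∫ t, h t * phaseIndicator N j (n * t)) - ∫ t, h t * phaseIndicator N 0 (n * t)))
      atTop (𝓝 0) := by
    simpa using tendsto_finsetSum (Finset.range N) fun j hj ↦
      tendsto_integral_mul_phaseIndicator_sub hh (Finset.mem_range.1 hj)
  have h1 := (tendsto_integral_mul_phaseIndicator_sub hh hi).sub (h0.const_mul (N : ℝ)⁻¹)
  have h2 := h1.add_const ((N : ℝ)⁻¹ * ∫ t, h t)
  simp only [mul_zero, sub_zero, zero_add] at h2
  refine h2.congr fun n ↦ ?_
  rw [Finset.sum_sub_distrib, hsum, Finset.sum_const, Finset.card_range, nsmul_eq_mul, mul_sub,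
    inv_mul_cancel_left₀ hN']
  ring

variable {T : ℝ}

/-- The law of `(t, fract (n t))` for `t` ranging over `(0, T]`. -/
noncomputable def phaseMeasure (T : ℝ) (n : ℕ) : Measure (ℝ × ℝ) :=
  (volume.restrict (Ioc 0 T)).map fun t ↦ (t, Int.fract (n * t))

lemma measurable_phase (n : ℕ) : Measurable fun t : ℝ ↦ (t, Int.fract (n * t)) :=
  measurable_id.prodMk (measurable_fract.comp (measurable_const.mul measurable_id))

instance (n : ℕ) : IsFiniteMeasure (phaseMeasure T n) := by
  unfold phaseMeasure; infer_instance

lemma phaseMeasure_real_univ (hT : 0 ≤ T) (n : ℕ) : (phaseMeasure T n).real univ = T := by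
  simp [phaseMeasure, measureReal_def, Measure.map_apply (measurable_phase n) MeasurableSet.univ,
    hT]

lemma ae_mem_phaseMeasure (n : ℕ) : ∀ᵐ p ∂(phaseMeasure T n), p ∈ Ioc 0 T ×ˢ Ico (0 : ℝ) 1 := by
  unfold phaseMeasure
  refine (ae_map_iff (measurable_phase n).aemeasurable
    (measurableSet_Ioc.prod measurableSet_Ico)).2 ?_
  filter_upwards [ae_restrict_mem measurableSet_Ioc] with t ht
  exact ⟨ht, Int.fract_nonneg _, Int.fract_lt_one _⟩

lemma measurable_step {h : ℕ → ℝ → ℝ} (hm : ∀ i, Measurable (h i)) (N : ℕ) :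
    Measurable fun p : ℝ × ℝ ↦ h ⌊N * p.2⌋₊ p.1 := by
  have h1 : Measurable fun p : ℕ × ℝ ↦ h p.1 p.2 := measurable_from_prod_countable_right hm
  exact h1.comp ((Nat.measurable_floor.comp (measurable_snd.const_mul (N : ℝ))).prodMk
    measurable_fst)

lemma tendsto_integral_step_phaseMeasure {h : ℕ → ℝ → ℝ} (hm : ∀ i, Measurable (h i)) {B : ℝ}
    (hB : ∀ i t, ‖h i t‖ ≤ B) {N : ℕ} (hN : 0 < N) :
    Tendsto (fun n ↦ ∫ p, h ⌊N * p.2⌋₊ p.1 ∂(phaseMeasure T n)) atTop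
      (𝓝 ((N : ℝ)⁻¹ * ∑ i ∈ Finset.range N, ∫ t in Ioc 0 T, h i t)) := by
  have hint : ∀ i, Integrable ((Ioc 0 T).indicator (h i)) := fun i ↦
    (integrable_indicator_iff measurableSet_Ioc).2
      (Integrable.of_bound (hm i).aestronglyMeasurable B (ae_of_all _ (hB i)))
  rw [Finset.mul_sum]
  have := tendsto_finsetSum (Finset.range N) fun i hi ↦
    tendsto_integral_mul_phaseIndicator (hint i) (Finset.mem_range.1 hi)
  simp only [integral_indicator measurableSet_Ioc] at this
  refine this.congr fun n ↦ ?_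
  rw [phaseMeasure, integral_map (measurable_phase n).aemeasurable
    (measurable_step hm N).aestronglyMeasurable, ← integral_indicator measurableSet_Ioc,
    ← integral_finsetSum _ fun i _ ↦ integrable_mul_phaseIndicator (hint i) N i n]
  refine integral_congr_ae (ae_of_all _ fun t ↦ ?_)
  refine (sum_mul_phaseIndicator hN (fun i ↦ (Ioc 0 T).indicator (h i) t) _).trans ?_
  by_cases ht : t ∈ Ioc 0 T <;> simp [ht]

lemma integral_step_unit {N : ℕ} (hN : 0 < N) (h : ℕ → ℝ) :
    ∫ s in Ico (0 : ℝ) 1, h ⌊N * s⌋₊ = (N : ℝ)⁻¹ * ∑ i ∈ Finset.range N, h i := by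
  have hN' : (0 : ℝ) < N := by exact_mod_cast hN
  have hvol : ∀ i ∈ Finset.range N,
      ∫ s in Ico (0 : ℝ) 1, phaseIndicator N i s = (N : ℝ)⁻¹ := by
    intro i hi
    have hi1 : (i : ℝ) + 1 ≤ N := by exact_mod_cast Finset.mem_range.1 hi
    have hsub : Ico ((i : ℝ) / N) ((i + 1) / N) ⊆ Ico 0 1 :=
      Ico_subset_Ico (by positivity) ((div_le_one hN').2 hi1)
    have : ∀ s ∈ Ico (0 : ℝ) 1,
        phaseIndicator N i s = (Ico ((i : ℝ) / N) ((i + 1) / N)).indicator 1 s := by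
      intro s hs
      rw [phaseIndicator, Int.fract_eq_self.2 hs, indicator]
      congr 1
      rw [Nat.floor_eq_iff (mul_nonneg hN'.le hs.1), mem_Ico, div_le_iff₀' hN', lt_div_iff₀' hN']
    rw [setIntegral_congr_fun measurableSet_Ico this, setIntegral_indicator measurableSet_Ico,
      inter_eq_right.2 hsub]
    simp [Real.volume_real_Ico, ← sub_div]
  have hint : ∀ i ∈ Finset.range N,
      Integrable (fun s ↦ h i * phaseIndicator N i s) (volume.restrict (Ico (0 : ℝ) 1)) :=
      fun i _ ↦ (Integrable.of_bound (measurable_phaseIndicator N i).aestronglyMeasurable 1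
      (ae_of_all _ (norm_phaseIndicator_le_one N i))).const_mul _
  have : ∀ s ∈ Ico (0 : ℝ) 1,
      h ⌊N * s⌋₊ = ∑ i ∈ Finset.range N, h i * phaseIndicator N i s := by
    intro s hs
    rw [sum_mul_phaseIndicator hN, Int.fract_eq_self.2 hs]
  rw [setIntegral_congr_fun measurableSet_Ico this, integral_finsetSum _ hint, Finset.mul_sum]
  refine Finset.sum_congr rfl fun i hi ↦ ?_
  rw [integral_const_mul, hvol i hi, mul_comm]

lemma integral_step_prod {h : ℕ → ℝ → ℝ} (hm : ∀ i, Measurable (h i)) {B : ℝ}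
    (hB : ∀ i t, ‖h i t‖ ≤ B) {N : ℕ} (hN : 0 < N) :
    ∫ p, h ⌊N * p.2⌋₊ p.1 ∂((volume.restrict (Ioc 0 T)).prod (volume.restrict (Ico (0 : ℝ) 1)))
      = (N : ℝ)⁻¹ * ∑ i ∈ Finset.range N, ∫ t in Ioc 0 T, h i t := by
  rw [integral_prod _ (Integrable.of_bound (measurable_step hm N).aestronglyMeasurable B
    (ae_of_all _ fun p ↦ hB _ _))]
  have : ∀ t, ∫ s in Ico (0 : ℝ) 1, h ⌊N * s⌋₊ t
      = (N : ℝ)⁻¹ * ∑ i ∈ Finset.range N, h i t := fun t ↦ integral_step_unit hN (fun i ↦ h i t)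
  simp only [this]
  rw [integral_const_mul, integral_finsetSum]
  exact fun i _ ↦ Integrable.of_bound (hm i).aestronglyMeasurable B (ae_of_all _ (hB i))

end Equidistribution

section Chattering

variable {T : ℝ}

lemma norm_integral_sub_step_le {X : Type*} [MeasurableSpace X] {l : Measure X} [IsFiniteMeasure l]
    {G S D : X → ℝ} (hG : Integrable G l) (hS : Integrable S l) (hD : Integrable D l) {ε C : ℝ}
    (h : ∀ᵐ p ∂l, |G p - S p| ≤ ε + C * D p) :
    |∫ p, G p ∂l - ∫ p, S p ∂l| ≤ ε * l.real univ + C * ∫ p, D p ∂l := by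
  rw [← integral_sub hG hS]
  refine (norm_integral_le_of_norm_le (f := fun p ↦ G p - S p) (g := fun p ↦ ε + C * D p)
    ((integrable_const ε).add (hD.const_mul C)) h).trans_eq ?_
  rw [integral_add (integrable_const ε) (hD.const_mul C), integral_const, integral_const_mul,
    smul_eq_mul, mul_comm ε]

/-- Convergence along the oscillating phases for integrands whose dependence on the phase is
controlled, up to arbitrarily small errors, by a monotone function. -/
theorem tendsto_integral_phaseMeasure (hT : 0 ≤ T) {G Q : ℝ → ℝ → ℝ}
    (hG : Measurable fun p : ℝ × ℝ ↦ G p.1 p.2) (hQ : Measurable fun p : ℝ × ℝ ↦ Q p.1 p.2)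
    {B : ℝ} (hGB : ∀ t s, |G t s| ≤ B) (hQI : ∀ t s, Q t s ∈ Icc (0 : ℝ) 1)
    (hmono : ∀ t, Monotone (Q t))
    (hmod : ∀ ε > 0, ∃ C ≥ 0, ∀ t ∈ Icc 0 T, ∀ s s',
      |G t s - G t s'| ≤ ε + C * |Q t s - Q t s'|) :
    Tendsto (fun n ↦ ∫ p, G p.1 p.2 ∂(phaseMeasure T n)) atTop
      (𝓝 (∫ p, G p.1 p.2 ∂((volume.restrict (Ioc 0 T)).prod
        (volume.restrict (Ico (0 : ℝ) 1))))) := by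
  set l := (volume.restrict (Ioc 0 T)).prod (volume.restrict (Ico (0 : ℝ) 1)) with hl
  have hl_univ : l.real univ = T := by
    rw [hl, measureReal_def, ← univ_prod_univ, Measure.prod_prod]
    simp [hT]
  have hl_mem : ∀ᵐ p ∂l, p ∈ Ioc 0 T ×ˢ Ico (0 : ℝ) 1 := by
    rw [hl, Measure.prod_restrict]
    exact ae_restrict_mem (measurableSet_Ioc.prod measurableSet_Ico)
  have hGm : ∀ s, Measurable fun t ↦ G t s := fun s ↦
    hG.comp (measurable_id.prodMk measurable_const)
  have hQm : ∀ s, Measurable fun t ↦ Q t s := fun s ↦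
    hQ.comp (measurable_id.prodMk measurable_const)
  rw [Metric.tendsto_atTop']
  intro η hη
  set ε : ℝ := η / (2 * (T + 3)) with hε
  have hε0 : 0 < ε := by positivity
  obtain ⟨C, hC0, hC⟩ := hmod ε hε0
  obtain ⟨N, hN⟩ := exists_nat_gt (C * T / ε)
  have hN0' : (0 : ℝ) < N := lt_of_le_of_lt (by positivity) hN
  have hN0 : 0 < N := by exact_mod_cast hN0'
  let hS : ℕ → ℝ → ℝ := fun i t ↦ G t (i / N)
  let hD : ℕ → ℝ → ℝ := fun i t ↦ Q t ((i + 1 : ℕ) / N) - Q t (i / N)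
  have hSm : ∀ i, Measurable (hS i) := fun i ↦ hGm _
  have hDm : ∀ i, Measurable (hD i) := fun i ↦ (hQm _).sub (hQm _)
  have hSB : ∀ i t, ‖hS i t‖ ≤ B := fun i t ↦ hGB _ _
  have hDB : ∀ i t, ‖hD i t‖ ≤ 1 := fun i t ↦ by
    have h1 := hQI t ((i + 1 : ℕ) / N)
    have h2 := hQI t (i / N)
    rw [Real.norm_eq_abs, abs_le]
    constructor <;> simp only [hD] <;> linarith [h1.1, h1.2, h2.1, h2.2]
  have hbound : ∀ m : Measure (ℝ × ℝ), IsFiniteMeasure m → m.real univ = T →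
      (∀ᵐ p ∂m, p ∈ Ioc 0 T ×ˢ Ico (0 : ℝ) 1) →
      |∫ p, G p.1 p.2 ∂m - ∫ p, hS ⌊N * p.2⌋₊ p.1 ∂m|
        ≤ ε * T + C * ∫ p, hD ⌊N * p.2⌋₊ p.1 ∂m := by
    intro m _ hm hmem
    rw [← hm]
    refine norm_integral_sub_step_le
      (.of_bound hG.aestronglyMeasurable B (ae_of_all _ fun p ↦ hGB _ _))
      (.of_bound (measurable_step hSm N).aestronglyMeasurable B (ae_of_all _ fun p ↦ hSB _ _))
      (.of_bound (measurable_step hDm N).aestronglyMeasurable 1 (ae_of_all _ fun p ↦ hDB _ _)) ?_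
    filter_upwards [hmem] with p hp
    refine (hC p.1 (Ioc_subset_Icc_self hp.1) _ _).trans ?_
    have h1 : (⌊N * p.2⌋₊ : ℝ) / N ≤ p.2 := by
      rw [div_le_iff₀' hN0']
      exact Nat.floor_le (mul_nonneg hN0'.le hp.2.1)
    have h2 : p.2 ≤ ((⌊N * p.2⌋₊ + 1 : ℕ) : ℝ) / N := by
      rw [le_div_iff₀' hN0']
      push_cast
      exact (Nat.lt_floor_add_one _).le
    have h3 := hmono p.1 h1
    have h4 := hmono p.1 h2
    rw [abs_of_nonneg (sub_nonneg.2 h3)]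
    simp only [hD]
    gcongr
  have hDlim := tendsto_integral_step_phaseMeasure (T := T) hDm hDB hN0
  have hDval := integral_step_prod (T := T) hDm hDB hN0
  have hDsmall : (N : ℝ)⁻¹ * ∑ i ∈ Finset.range N, ∫ t in Ioc 0 T, hD i t ≤ (N : ℝ)⁻¹ * T := by
    have hint : ∀ i ∈ Finset.range N, Integrable (hD i) (volume.restrict (Ioc 0 T)) := fun i _ ↦
      .of_bound (hDm i).aestronglyMeasurable 1 (ae_of_all _ (hDB i))
    rw [← integral_finsetSum _ hint]
    have htel : ∀ t, ∑ i ∈ Finset.range N, hD i t ≤ 1 := fun t ↦ by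
      rw [Finset.sum_range_sub (fun i : ℕ ↦ Q t (i / N))]
      linarith [(hQI t (N / N)).2, (hQI t ((0 : ℕ) / N)).1]
    gcongr
    calc ∫ t in Ioc 0 T, ∑ i ∈ Finset.range N, hD i t ≤ ∫ t in Ioc 0 T, (1 : ℝ) :=
          integral_mono (integrable_finsetSum _ hint) (integrable_const _) htel
      _ = T := by simp [hT]
  have hCN : C * ((N : ℝ)⁻¹ * T) < ε := by
    rw [div_lt_iff₀ hε0] at hN
    rw [← mul_assoc, mul_comm C, mul_assoc, inv_mul_lt_iff₀ hN0']
    exact hN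
  have hSlim := tendsto_integral_step_phaseMeasure (T := T) hSm hSB hN0
  rw [← integral_step_prod hSm hSB hN0, ← hl] at hSlim
  have hl_bound := hbound l inferInstance hl_univ hl_mem
  rw [hl, hDval, ← hl] at hl_bound
  have hev1 := (hDlim.const_mul C).eventually_lt_const
    ((mul_le_mul_of_nonneg_left hDsmall hC0).trans_lt hCN)
  have hev2 := hSlim.eventually (Metric.ball_mem_nhds _ hε0)
  obtain ⟨n₀, hn₀⟩ := eventually_atTop.1 (hev1.and hev2)
  refine ⟨n₀, fun n hn ↦ ?_⟩
  obtain ⟨h1, h2⟩ := hn₀ n hn.le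
  have h3 := hbound (phaseMeasure T n) inferInstance (phaseMeasure_real_univ hT n)
    (ae_mem_phaseMeasure n)
  have h4 := mul_le_mul_of_nonneg_left hDsmall hC0
  rw [Real.dist_eq, abs_lt] at h2
  rw [abs_le] at h3 hl_bound
  have hη' : η = 2 * ε * T + 6 * ε := by rw [hε]; field_simp; ring
  rw [Real.dist_eq, abs_lt]
  constructor <;> linarith [h2.1, h2.2, h3.1, h3.2, hl_bound.1, hl_bound.2]

lemma IsCompact.exists_abs_sub_le_add_mul_dist {X : Type*} [PseudoMetricSpace X] {K : Set X}
    (hK : IsCompact K) {g : X → ℝ} (hg : ContinuousOn g K) {ε : ℝ} (hε : 0 < ε) :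
    ∃ C ≥ 0, ∀ x ∈ K, ∀ y ∈ K, |g x - g y| ≤ ε + C * dist x y := by
  obtain ⟨B, hB⟩ := hK.exists_bound_of_continuousOn hg
  obtain ⟨δ, hδ, h⟩ := Metric.uniformContinuousOn_iff.1
    (hK.uniformContinuousOn_of_continuous hg) ε hε
  refine ⟨2 * |B| / δ, by positivity, fun x hx y hy ↦ ?_⟩
  rcases lt_or_ge (dist x y) δ with hd | hd
  · have := (h x hx y hy hd).le
    rw [Real.dist_eq] at this
    exact this.trans (le_add_of_nonneg_right (by positivity))
  · have h1 : |g x - g y| ≤ 2 * |B| := by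
      have := abs_sub (g x) (g y)
      have h2 := (hB x hx).trans (le_abs_self B)
      have h3 := (hB y hy).trans (le_abs_self B)
      rw [Real.norm_eq_abs] at h2 h3
      linarith
    have h2 : 2 * |B| ≤ 2 * |B| / δ * dist x y := by
      rw [div_mul_eq_mul_div, le_div_iff₀ hδ]
      gcongr
    linarith

lemma integral_quantileOn {X : Type*} [TopologicalSpace X] [MeasurableSpace X] [BorelSpace X]
    {μ : Measure X} [IsProbabilityMeasure μ] {K : Set ℝ} (hK : IsCompact K) {A : Set X}
    (hA : μ Aᶜ = 0) {π : ℝ → X} (hπ : Continuous π) {e : X → ℝ} (he : Measurable e)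
    (hπe : ∀ x ∈ A, e x ∈ K ∧ π (e x) = x) {f : X → ℝ} (hf : Continuous f) :
    ∫ s in Ico (0 : ℝ) 1, f (π (quantileOn K (μ.map e) s)) = ∫ x, f x ∂μ := by
  have : IsProbabilityMeasure (μ.map e) := Measure.isProbabilityMeasure_map he.aemeasurable
  have hAae : ∀ᵐ x ∂μ, x ∈ A := hA
  have hν : μ.map e Kᶜ = 0 := by
    rw [Measure.map_apply he hK.measurableSet.compl]
    exact measure_mono_null (fun x hx hxA ↦ hx (hπe x hxA).1) hA
  have hmeas : AEMeasurable (quantileOn K (μ.map e)) (volume.restrict (Ico (0 : ℝ) 1)) :=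
    aemeasurable_restrict_of_monotoneOn measurableSet_Ico
      ((monotoneOn_quantileOn hK hν).mono fun x hx ↦ hx.2.le)
  have hfπ : StronglyMeasurable (f ∘ π) := (hf.comp hπ).stronglyMeasurable
  have h1 := integral_map hmeas hfπ.aestronglyMeasurable
  rw [map_quantileOn hK hν, integral_map he.aemeasurable hfπ.aestronglyMeasurable] at h1
  refine h1.symm.trans (integral_congr_ae ?_)
  filter_upwards [hAae] with x hx
  simp [(hπe x hx).2]

end Chattering

/-- Chattering Lemma. On a filtered probability space `(Ω, 𝓕, (𝓕_t), P)`, let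
`A₁ ⊂ ℝ^k` be nonempty and compact and let `(q_t)_{t ∈ [0,T]}` be a progressively
measurable process with values in the Borel probability measures on `A₁` (with the
topology of weak convergence). Then there exists a sequence of progressively measurable
`A₁`-valued processes `(uⁿ_t)` such that, `P`-almost surely, the measures
`δ_{uⁿ_t}(da) dt` converge weakly to `q_t(da) dt` on `[0,T] × A₁`: for every bounded
continuous `f`, `∫₀ᵀ f(t, uⁿ_t) dt → ∫₀ᵀ ∫_{A₁} f(t,a) q_t(da) dt`. -/
theorem chattering_lemma {Ω : Type*} [mΩ : MeasurableSpace Ω]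
    (P : Measure Ω) [IsProbabilityMeasure P] (F : Filtration ℝ mΩ)
    (T : ℝ) (hT : 0 < T) {k : ℕ}
    (A₁ : Set (Fin k → ℝ)) (hne : A₁.Nonempty) (hcomp : IsCompact A₁)
    (q : ℝ → Ω → ProbabilityMeasure (Fin k → ℝ))
    (hprog : ProgMeasurable F q)
    (hsupp : ∀ t ω, (q t ω : Measure (Fin k → ℝ)) A₁ᶜ = 0) :
    ∃ u : ℕ → ℝ → Ω → Fin k → ℝ,
      (∀ n, ProgMeasurable F (u n)) ∧ (∀ n t ω, u n t ω ∈ A₁) ∧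
      ∀ᵐ ω ∂P, ∀ f : ℝ × (Fin k → ℝ) → ℝ, Continuous f → (∃ C : ℝ, ∀ p, |f p| ≤ C) →
        Tendsto (fun n : ℕ => ∫ t in (0 : ℝ)..T, f (t, u n t ω)) atTop
          (𝓝 (∫ t in (0 : ℝ)..T, ∫ a, f (t, a) ∂(q t ω : Measure (Fin k → ℝ)))) := by
  obtain ⟨π, e, he, hπA, hπe⟩ := exists_continuousMap_measurable_section hne hcomp
  have hK := isCompact_cantorSet
  let ν : ℝ → Ω → Measure ℝ := fun t ω ↦ (q t ω : Measure (Fin k → ℝ)).map e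
  have hνp : ∀ t ω, IsProbabilityMeasure (ν t ω) := fun t ω ↦
    Measure.isProbabilityMeasure_map he.aemeasurable
  have hνK : ∀ t ω, ν t ω cantorSetᶜ = 0 := fun t ω ↦ by
    rw [Measure.map_apply he hK.measurableSet.compl]
    exact measure_mono_null (fun x hx hxA ↦ hx (hπe x hxA).1) (hsupp t ω)
  have hνm : ∀ i, Measurable[Subtype.instMeasurableSpace.prod (F i)]
      fun p : Iic i × Ω ↦ ν p.1 p.2 := fun i ↦
    (Measure.measurable_map e he).comp (hprog i).measurable_toMeasure
  refine ⟨fun n t ω ↦ π (quantileOn cantorSet (ν t ω) (Int.fract (n * t))), fun n i ↦ ?_,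
    fun n t ω ↦ hπA (quantileOn_mem hK (hνK t ω) (Int.fract_lt_one _).le).1,
    ae_of_all _ fun ω f hf ⟨B, hB⟩ ↦ ?_⟩
  · have hfst : Measurable[Subtype.instMeasurableSpace.prod (F i)] fun p : Iic i × Ω ↦ p.1 :=
      @measurable_fst _ _ _ (F i)
    have hs := measurable_fract.comp ((measurable_subtype_coe.comp hfst).const_mul (n : ℝ))
    exact (π.continuous.measurable.comp (measurable_quantileOn (hνm i) hK
      (fun p ↦ hνK p.1 p.2) hs fun p ↦ (Int.fract_lt_one _).le)).stronglyMeasurable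
  let Q : ℝ → ℝ → ℝ := fun t s ↦ quantileOn cantorSet (ν (min t T) ω) (min s 1)
  let G : ℝ → ℝ → ℝ := fun t s ↦ f (t, π (Q t s))
  have hQ : Measurable fun p : ℝ × ℝ ↦ Q p.1 p.2 := by
    have hmin : Measurable[_, Subtype.instMeasurableSpace.prod (F T)]
        fun p : ℝ × ℝ ↦ ((⟨min p.1 T, mem_Iic.2 (min_le_right _ _)⟩ : Iic T), ω) :=
      @Measurable.prodMk _ _ _ _ _ (F T) _ _
        ((measurable_fst.min measurable_const).subtype_mk) measurable_const
    have hν' : Measurable fun p : ℝ × ℝ ↦ ν (min p.1 T) ω := (hνm T).comp hmin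
    exact measurable_quantileOn hν' hK (fun p ↦ hνK _ _) (measurable_snd.min measurable_const)
      fun p ↦ min_le_right _ _
  have hG : Measurable fun p : ℝ × ℝ ↦ G p.1 p.2 :=
    hf.measurable.comp (measurable_fst.prodMk (π.continuous.measurable.comp hQ))
  have hQI : ∀ t s, Q t s ∈ Icc (0 : ℝ) 1 := fun t s ↦
    cantorSet_subset_unitInterval (quantileOn_mem hK (hνK _ ω) (min_le_right _ _)).1
  have hmono : ∀ t, Monotone (Q t) := fun t s s' h ↦
    monotoneOn_quantileOn hK (hνK _ ω) (mem_Iic.2 (min_le_right _ _)) (mem_Iic.2 (min_le_right _ _))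
      (min_le_min_right _ h)
  have hmod : ∀ ε > 0, ∃ C ≥ 0, ∀ t ∈ Icc 0 T, ∀ s s',
      |G t s - G t s'| ≤ ε + C * |Q t s - Q t s'| := by
    intro ε hε
    have hg : Continuous fun p : ℝ × ℝ ↦ f (p.1, π p.2) :=
      hf.comp (continuous_fst.prodMk (π.continuous.comp continuous_snd))
    obtain ⟨C, hC0, hC⟩ := (isCompact_Icc.prod isCompact_Icc :
      IsCompact (Icc 0 T ×ˢ Icc (0 : ℝ) 1)).exists_abs_sub_le_add_mul_dist hg.continuousOn hε
    refine ⟨C, hC0, fun t ht s s' ↦ (hC (t, Q t s) ⟨ht, hQI t s⟩ (t, Q t s')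
      ⟨ht, hQI t s'⟩).trans_eq ?_⟩
    simp [Prod.dist_eq, Real.dist_eq]
  have key := tendsto_integral_phaseMeasure hT.le hG hQ (fun t s ↦ hB _) hQI hmono hmod
  have hlim : ∫ p, G p.1 p.2 ∂((volume.restrict (Ioc 0 T)).prod (volume.restrict (Ico (0 : ℝ) 1)))
      = ∫ t in (0 : ℝ)..T, ∫ a, f (t, a) ∂(q t ω : Measure (Fin k → ℝ)) := by
    rw [integral_prod _ (.of_bound hG.aestronglyMeasurable B (ae_of_all _ fun p ↦ hB _)),
      intervalIntegral.integral_of_le hT.le]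
    refine setIntegral_congr_fun measurableSet_Ioc fun t ht ↦ ?_
    rw [← integral_quantileOn hK (hsupp t ω) π.continuous he hπe (f := fun a ↦ f (t, a))
      (by fun_prop)]
    refine setIntegral_congr_fun measurableSet_Ico fun s hs ↦ ?_
    simp only [G, Q, ν, min_eq_left ht.2, min_eq_left hs.2.le]
  rw [hlim] at key
  refine key.congr fun n ↦ ?_
  rw [phaseMeasure, integral_map (measurable_phase n).aemeasurable hG.aestronglyMeasurable,
    intervalIntegral.integral_of_le hT.le]
  refine setIntegral_congr_fun measurableSet_Ioc fun t ht ↦ ?_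
  simp only [G, Q, min_eq_left ht.2, min_eq_left (Int.fract_lt_one _).le]
end
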